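/- Fix t ≥ 1 and β_r > 0. Let f_⋆, f̂_t : C × S × A → [0,1] be context-dependent reward functions, let P_⋆ and P̂_t be context-dependent dynamics, and let π_1, …, π_{t−1} ∈ Π_C be context-dependent policies used to define the bonus b^R_t. Then for every context-dependent policy π ∈ Π_C: | E_c[ V^{π(c;·)}_{M^{(f_⋆,P̂_t)}(c)}(s_0) − V^{π(c;·)}_{M^{(f̂_t,P̂_t)}(c)}(s_0) ] | ≤ E_c[ Σ_{h=0}^{H−1} Σ_{s∈S_h} Σ_{a∈A} q_h(s,a|π(c;·),P̂^c_t) · b^R_t(c,s,a) ] + (3/(2β_r)) · E_c[ Σ_{i=1}^{t−1} E_{π_i(c;·),P^c_⋆}[ Σ_{h=0}^{H−1} ( f_⋆(c,s_h,a_h) − f̂_t(c,s_h,a_h) )² | s_0 ] ] + (9H²/(2β_r)) · E_c[ Σ_{i=1}^{t−1} E_{π_i(c;·),P^c_⋆}[ Σ_{h=0}^{H−1} D_H²(P^c_⋆(·|s_h,a_h), P̂^c_t(·|s_h,a_h)) | s_0 ] ] + H/(2β_r). -/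

import Mathlib

open scoped BigOperators Classical
open Finset

noncomputable section

/-- Squared Hellinger distance between two distributions on a finite set. -/
def hellingerSq {X : Type*} [Fintype X] (P Q : X → ℝ) : ℝ :=
  ∑ x, (Real.sqrt (P x) - Real.sqrt (Q x)) ^ 2

variable {S : ℕ → Type} [∀ h, Fintype (S h)] {A : Type} [Fintype A]

/-- Value function of a deterministic policy in a layered MDP, defined by the backward
Bellman recursion: `val P r pol k h s` is the value with `k` steps to go, starting at
state `s` in layer `h`.  The layer-`h` value function of the horizon-`H` MDP is
`val P r pol (H - h) h`. -/
def val (P : ∀ h, S h → A → S (h + 1) → ℝ) (r : ∀ h, S h → A → ℝ)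
    (pol : ∀ h, S h → A) : (k : ℕ) → (h : ℕ) → S h → ℝ
  | 0, _, _ => 0
  | k + 1, h, s =>
      r h s (pol h s) + ∑ s' : S (h + 1), P h s (pol h s) s' * val P r pol k (h + 1) s'

/-- State-occupancy measure: `stateOcc P pol h0 st k s` is the probability of being at
state `s` in layer `h0 + k` when acting with the deterministic policy `pol` under
dynamics `P`, starting from state `st` in layer `h0`. -/
def stateOcc (P : ∀ h, S h → A → S (h + 1) → ℝ) (pol : ∀ h, S h → A)
    (h0 : ℕ) (st : S h0) : (k : ℕ) → S (h0 + k) → ℝ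
  | 0, s => if s = st then 1 else 0
  | k + 1, s' =>
      ∑ s : S (h0 + k), stateOcc P pol h0 st k s * P (h0 + k) s (pol (h0 + k) s) s'

/-- State-action occupancy measure started at `st` in layer `h0`. -/
def occ (P : ∀ h, S h → A → S (h + 1) → ℝ) (pol : ∀ h, S h → A)
    (h0 : ℕ) (st : S h0) (k : ℕ) (s : S (h0 + k)) (a : A) : ℝ :=
  if a = pol (h0 + k) s then stateOcc P pol h0 st k s else 0

/-- State-occupancy measure started from the initial state `s0` of layer `0`:
probability of being at state `s` in layer `h`. -/
def stateOcc0 (P : ∀ h, S h → A → S (h + 1) → ℝ) (pol : ∀ h, S h → A)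
    (s0 : S 0) : (h : ℕ) → S h → ℝ
  | 0, s => if s = s0 then 1 else 0
  | h + 1, s' => ∑ s : S h, stateOcc0 P pol s0 h s * P h s (pol h s) s'

/-- State-action occupancy measure `q_h(s, a | pol, P)` started from the initial state. -/
def occ0 (P : ∀ h, S h → A → S (h + 1) → ℝ) (pol : ∀ h, S h → A)
    (s0 : S 0) (h : ℕ) (s : S h) (a : A) : ℝ :=
  if a = pol h s then stateOcc0 P pol s0 h s else 0


variable {C : Type} [Fintype C]

/-- Reward bonus `b^R_t(c,s,a)` built from the past policies `pols 0, …, pols (t-2)`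
(representing `π_1, …, π_{t-1}`) and the approximated dynamics `Phat`. -/
def bonusR (Phat : C → ∀ h, S h → A → S (h + 1) → ℝ)
    (pols : ℕ → C → ∀ h, S h → A) (s0 : S 0) (t : ℕ) (br : ℝ)
    (c : C) (h : ℕ) (s : S h) (a : A) : ℝ :=
  min 1 ((br / 2) / (1 + ∑ i ∈ Finset.range (t - 1), occ0 (Phat c) (pols i c) s0 h s a))

/-- Reward bonus `b^P_t(c,s,a)` built from the past policies `pols 0, …, pols (t-2)`
(representing `π_1, …, π_{t-1}`) and the approximated dynamics `Phat`. -/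
def bonusP (Phat : C → ∀ h, S h → A → S (h + 1) → ℝ)
    (pols : ℕ → C → ∀ h, S h → A) (s0 : S 0) (t : ℕ) (bp : ℝ) (H : ℕ)
    (c : C) (h : ℕ) (s : S h) (a : A) : ℝ :=
  min (H : ℝ)
    ((bp * H / 2) / (1 + ∑ i ∈ Finset.range (t - 1), occ0 (Phat c) (pols i c) s0 h s a))

/-- Summing over actions against the occupancy of a deterministic policy. -/
lemma sum_occ0_mul (P : ∀ h, S h → A → S (h + 1) → ℝ) (pol : ∀ h, S h → A)
    (s0 : S 0) (h : ℕ) (s : S h) (g : A → ℝ) :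
    ∑ a : A, occ0 P pol s0 h s a * g a = stateOcc0 P pol s0 h s * g (pol h s) := by
  simp [occ0, ite_mul]

section Occupancy

set_option linter.unusedSectionVars false

variable {P Q : ∀ h, S h → A → S (h + 1) → ℝ} {H : ℕ}

lemma stateOcc0_nonneg (hP0 : ∀ h, h < H → ∀ s a s', 0 ≤ P h s a s')
    (pol : ∀ h, S h → A) (s0 : S 0) :
    ∀ h, h ≤ H → ∀ s, 0 ≤ stateOcc0 P pol s0 h s
  | 0, _, s => by
      rw [stateOcc0]
      split_ifs <;> norm_num
  | h + 1, hh, s' => by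
      rw [stateOcc0]
      exact Finset.sum_nonneg fun s _ =>
        mul_nonneg (stateOcc0_nonneg hP0 pol s0 h (by omega) s) (hP0 h (by omega) _ _ _)

lemma sum_stateOcc0 (hP1 : ∀ h, h < H → ∀ s a, (∑ s', P h s a s') = 1)
    (pol : ∀ h, S h → A) (s0 : S 0) :
    ∀ h, h ≤ H → ∑ s, stateOcc0 P pol s0 h s = 1
  | 0, _ => by simp [stateOcc0]
  | h + 1, hh => by
      simp only [stateOcc0]
      rw [Finset.sum_comm]
      simp only [← Finset.mul_sum, hP1 h (by omega), mul_one]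
      exact sum_stateOcc0 hP1 pol s0 h (by omega)

lemma occ0_nonneg (hP0 : ∀ h, h < H → ∀ s a s', 0 ≤ P h s a s')
    (pol : ∀ h, S h → A) (s0 : S 0) {h : ℕ} (hh : h ≤ H) (s : S h) (a : A) :
    0 ≤ occ0 P pol s0 h s a := by
  rw [occ0]
  split_ifs
  exacts [stateOcc0_nonneg hP0 pol s0 h hh s, le_rfl]

/-- Integrating a next-state function against the occupancy pushes it one layer forward. -/
lemma sum_stateOcc0_succ (P : ∀ h, S h → A → S (h + 1) → ℝ) (pol : ∀ h, S h → A) (s0 : S 0)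
    (h : ℕ) (v : S (h + 1) → ℝ) :
    ∑ s, stateOcc0 P pol s0 h s * ∑ s', P h s (pol h s) s' * v s' =
      ∑ s', stateOcc0 P pol s0 (h + 1) s' * v s' := by
  simp only [stateOcc0, Finset.mul_sum, Finset.sum_mul]
  rw [Finset.sum_comm]
  simp only [mul_assoc]

/-- The value is the expected cumulative reward under the occupancy measure. -/
lemma val_eq_sum_stateOcc0 (P : ∀ h, S h → A → S (h + 1) → ℝ) (g : ∀ h, S h → A → ℝ)
    (pol : ∀ h, S h → A) (s0 : S 0) (H : ℕ) :
    val P g pol H 0 s0 =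
      ∑ h ∈ Finset.range H, ∑ s : S h, stateOcc0 P pol s0 h s * g h s (pol h s) := by
  have key : ∀ n k : ℕ, n + k = H → val P g pol H 0 s0 =
      (∑ h ∈ Finset.range n, ∑ s : S h, stateOcc0 P pol s0 h s * g h s (pol h s)) +
        ∑ s : S n, stateOcc0 P pol s0 n s * val P g pol k n s := by
    intro n
    induction n with
    | zero =>
      intro k hk
      obtain rfl : k = H := by omega
      simp [stateOcc0]
    | succ n ih =>
      intro k hk
      rw [ih (k + 1) (by omega), Finset.sum_range_succ, add_assoc, ← sum_stateOcc0_succ,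
        ← Finset.sum_add_distrib]
      simp only [_root_.val, mul_add]
  simpa [_root_.val] using key H 0 (by omega)

lemma val_mem_Icc (hP0 : ∀ h, h < H → ∀ s a s', 0 ≤ P h s a s')
    (hP1 : ∀ h, h < H → ∀ s a, (∑ s', P h s a s') = 1)
    {g : ∀ h, S h → A → ℝ} (hg : ∀ h s a, 0 ≤ g h s a ∧ g h s a ≤ 1) (pol : ∀ h, S h → A) :
    ∀ k h, h + k ≤ H → ∀ s, 0 ≤ val P g pol k h s ∧ val P g pol k h s ≤ k
  | 0, _, _, _ => by simp [_root_.val]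
  | k + 1, h, hk, s => by
      have ih := val_mem_Icc hP0 hP1 hg pol k (h + 1) (by omega)
      have h0 := hP0 h (by omega) s (pol h s)
      have hle : ∑ s', P h s (pol h s) s' * val P g pol k (h + 1) s' ≤ k :=
        calc _ ≤ ∑ s', P h s (pol h s) s' * (k : ℝ) :=
              Finset.sum_le_sum fun s' _ => mul_le_mul_of_nonneg_left (ih s').2 (h0 s')
          _ = k := by rw [← Finset.sum_mul, hP1 h (by omega), one_mul]
      have hge : 0 ≤ ∑ s', P h s (pol h s) s' * val P g pol k (h + 1) s' :=
        Finset.sum_nonneg fun s' _ => mul_nonneg (h0 s') (ih s').1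
      rw [_root_.val]
      push_cast
      constructor <;> linarith [(hg h s (pol h s)).1, (hg h s (pol h s)).2]

lemma hellingerSq_nonneg {X : Type*} [Fintype X] (p q : X → ℝ) : 0 ≤ hellingerSq p q :=
  Finset.sum_nonneg fun _ _ => sq_nonneg _

/-- Change of measure with a multiplicative loss `1 + 1 / K` and a Hellinger penalty. -/
lemma sum_mul_le_add_hellingerSq {X : Type*} [Fintype X] {p q v : X → ℝ} {K B : ℝ} (hK : 0 < K)
    (hp : ∀ x, 0 ≤ p x) (hq : ∀ x, 0 ≤ q x) (hv0 : ∀ x, 0 ≤ v x) (hvB : ∀ x, v x ≤ B) :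
    ∑ x, q x * v x ≤ (1 + 1 / K) * ∑ x, p x * v x + (1 + K) * B * hellingerSq p q := by
  rw [hellingerSq, Finset.mul_sum, Finset.mul_sum, ← Finset.sum_add_distrib]
  refine Finset.sum_le_sum fun x _ => ?_
  have hp2 := Real.sq_sqrt (hp x)
  have hq2 := Real.sq_sqrt (hq x)
  set a := Real.sqrt (p x)
  set b := Real.sqrt (q x)
  have h1 : q x ≤ (1 + 1 / K) * p x + (1 + K) * (a - b) ^ 2 := by
    have h2 : (1 + 1 / K) * a ^ 2 + (1 + K) * (a - b) ^ 2 - b ^ 2 =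
        (a + K * (a - b)) ^ 2 / K := by
      field_simp
      ring
    have h3 : 0 ≤ (a + K * (a - b)) ^ 2 / K := by positivity
    rw [← hp2, ← hq2]
    linarith
  calc q x * v x ≤ ((1 + 1 / K) * p x + (1 + K) * (a - b) ^ 2) * v x :=
        mul_le_mul_of_nonneg_right h1 (hv0 x)
    _ = (1 + 1 / K) * (p x * v x) + (1 + K) * (a - b) ^ 2 * v x := by ring
    _ ≤ (1 + 1 / K) * (p x * v x) + (1 + K) * (a - b) ^ 2 * B := by
        have := mul_le_mul_of_nonneg_left (hvB x)
          (show 0 ≤ (1 + K) * (a - b) ^ 2 by positivity)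
        linarith
    _ = _ := by ring

lemma one_add_one_div_pow_le_three {H n : ℕ} (hH : 1 ≤ H) (hn : n ≤ H) :
    (1 + 1 / (H : ℝ)) ^ n ≤ 3 := by
  have hH' : (0 : ℝ) < H := by exact_mod_cast hH
  calc (1 + 1 / (H : ℝ)) ^ n ≤ (1 + 1 / (H : ℝ)) ^ H :=
        pow_le_pow_right₀ (by linarith [one_div_pos.2 hH']) hn
    _ ≤ Real.exp (1 / H) ^ H := by
        gcongr
        linarith [Real.add_one_le_exp (1 / (H : ℝ))]
    _ = Real.exp 1 := by
        rw [← Real.exp_nat_mul]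
        congr 1
        field_simp
    _ ≤ 3 := Real.exp_one_lt_three.le

/-- Multiplicative value change of measure between two dynamics. -/
lemma val_le_change_of_measure (hH : 1 ≤ H)
    (hP0 : ∀ h, h < H → ∀ s a s', 0 ≤ P h s a s')
    (hQ0 : ∀ h, h < H → ∀ s a s', 0 ≤ Q h s a s')
    (hQ1 : ∀ h, h < H → ∀ s a, (∑ s', Q h s a s') = 1)
    {g : ∀ h, S h → A → ℝ} (hg : ∀ h s a, 0 ≤ g h s a ∧ g h s a ≤ 1)
    (pol : ∀ h, S h → A) (s0 : S 0) :
    val Q g pol H 0 s0 ≤ 3 * ∑ h ∈ Finset.range H, ∑ s : S h, stateOcc0 P pol s0 h s *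
      (g h s (pol h s) + (H : ℝ) ^ 2 * hellingerSq (P h s (pol h s)) (Q h s (pol h s))) := by
  have hH' : (0 : ℝ) < H := by exact_mod_cast hH
  set x : ℝ := 1 + 1 / (H : ℝ) with hx
  have hx0 : 0 ≤ x := by positivity
  set u : ℕ → ℝ := fun h => ∑ s : S h, stateOcc0 P pol s0 h s *
      (g h s (pol h s) + (H : ℝ) ^ 2 * hellingerSq (P h s (pol h s)) (Q h s (pol h s))) with hu
  have hu0 : ∀ h, h ≤ H → 0 ≤ u h := fun h hh => Finset.sum_nonneg fun s _ =>
    mul_nonneg (stateOcc0_nonneg hP0 pol s0 h hh s)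
      (add_nonneg (hg _ _ _).1 (mul_nonneg (sq_nonneg _) (hellingerSq_nonneg _ _)))
  have step : ∀ n k : ℕ, n + (k + 1) = H →
      ∑ s : S n, stateOcc0 P pol s0 n s * val Q g pol (k + 1) n s ≤
        u n + x * ∑ s : S (n + 1), stateOcc0 P pol s0 (n + 1) s * val Q g pol k (n + 1) s := by
    intro n k hk
    rw [← sum_stateOcc0_succ, Finset.mul_sum, ← Finset.sum_add_distrib]
    refine Finset.sum_le_sum fun s _ => ?_
    have hv := val_mem_Icc hQ0 hQ1 hg pol k (n + 1) (by omega)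
    have h1 := sum_mul_le_add_hellingerSq hH' (hP0 n (by omega) s (pol n s))
      (hQ0 n (by omega) s (pol n s)) (fun s' => (hv s').1) (fun s' => (hv s').2)
    have hkH : (k : ℝ) + 1 ≤ H := by
      have : k + 1 ≤ H := by omega
      exact_mod_cast this
    have h2 : (1 + (H : ℝ)) * k ≤ (H : ℝ) ^ 2 := by nlinarith
    have h3 := mul_le_mul_of_nonneg_right h2
      (hellingerSq_nonneg (P n s (pol n s)) (Q n s (pol n s)))
    have h4 : val Q g pol (k + 1) n s ≤
        (g n s (pol n s) + (H : ℝ) ^ 2 * hellingerSq (P n s (pol n s)) (Q n s (pol n s))) +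
          x * ∑ s', P n s (pol n s) s' * val Q g pol k (n + 1) s' := by
      rw [_root_.val]
      linarith
    have h5 := mul_le_mul_of_nonneg_left h4 (stateOcc0_nonneg hP0 pol s0 n (by omega) s)
    linarith
  have key : ∀ n k : ℕ, n + k = H → val Q g pol H 0 s0 ≤
      (∑ h ∈ Finset.range n, x ^ h * u h) +
        x ^ n * ∑ s : S n, stateOcc0 P pol s0 n s * val Q g pol k n s := by
    intro n
    induction n with
    | zero =>
      intro k hk
      obtain rfl : k = H := by omega
      simp [stateOcc0]
    | succ n ih =>
      intro k hk
      have h1 := ih (k + 1) (by omega)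
      have h2 := mul_le_mul_of_nonneg_left (step n k (by omega)) (pow_nonneg hx0 n)
      rw [Finset.sum_range_succ, pow_succ]
      linarith
  have hfin := key H 0 (by omega)
  simp only [_root_.val, mul_zero, Finset.sum_const_zero, add_zero] at hfin
  refine hfin.trans ?_
  rw [Finset.mul_sum]
  refine Finset.sum_le_sum fun h hh => ?_
  have hlt := (Finset.mem_range.1 hh).le
  exact mul_le_mul_of_nonneg_right (one_add_one_div_pow_le_three hH hlt) (hu0 h hlt)

end Occupancy

/-- A bounded error is controlled by the clipped bonus plus a weighted squared error. -/
lemma abs_le_min_add_sq {d b N : ℝ} (hd : |d| ≤ 1) (hb : 0 < b) (hN : 0 < N) :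
    |d| ≤ min 1 ((b / 2) / N) + 1 / (2 * b) * (N * d ^ 2) := by
  have h0 : 0 ≤ 1 / (2 * b) * (N * d ^ 2) := by positivity
  rcases min_cases 1 ((b / 2) / N) with ⟨h, _⟩ | ⟨h, _⟩ <;> rw [h]
  · linarith
  · have h1 : (b / 2) / N + 1 / (2 * b) * (N * |d| ^ 2) - |d| =
        (b - N * |d|) ^ 2 / (2 * b * N) := by
      field_simp
      ring
    have h2 : 0 ≤ (b - N * |d|) ^ 2 / (2 * b * N) := by positivity
    rw [sq_abs] at h1
    linarith

/-- Reward confidence bound with all occupancies taken under the approximated dynamics. -/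
lemma abs_val_sub_le_bonus {Q : ∀ h, S h → A → S (h + 1) → ℝ} {H : ℕ}
    (hQ0 : ∀ h, h < H → ∀ s a s', 0 ≤ Q h s a s')
    (hQ1 : ∀ h, h < H → ∀ s a, (∑ s', Q h s a s') = 1)
    {f g : ∀ h, S h → A → ℝ} (hfg : ∀ h s a, |f h s a - g h s a| ≤ 1)
    (pols : ℕ → ∀ h, S h → A) (pol : ∀ h, S h → A) (s0 : S 0) (n : ℕ) {br : ℝ} (hbr : 0 < br) :
    |val Q f pol H 0 s0 - val Q g pol H 0 s0| ≤
      (∑ h ∈ Finset.range H, ∑ s : S h, ∑ a : A, occ0 Q pol s0 h s a *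
        min 1 ((br / 2) / (1 + ∑ i ∈ Finset.range n, occ0 Q (pols i) s0 h s a))) +
      1 / (2 * br) * ∑ i ∈ Finset.range n,
        val Q (fun h s a => (f h s a - g h s a) ^ 2) (pols i) H 0 s0 +
      H / (2 * br) := by
  have hH : (H : ℝ) / (2 * br) = ∑ h ∈ Finset.range H, 1 / (2 * br) := by
    simp
    ring
  simp only [val_eq_sum_stateOcc0, ← Finset.sum_sub_distrib, ← mul_sub]
  rw [Finset.sum_comm (s := Finset.range n), hH, Finset.mul_sum, ← Finset.sum_add_distrib,
    ← Finset.sum_add_distrib]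
  refine (Finset.abs_sum_le_sum_abs _ _).trans (Finset.sum_le_sum fun h hh => ?_)
  have hlt := (Finset.mem_range.1 hh).le
  have hone : 1 / (2 * br) = ∑ s : S h, stateOcc0 Q pol s0 h s * (1 / (2 * br)) := by
    rw [← Finset.sum_mul, sum_stateOcc0 hQ1 pol s0 h hlt, one_mul]
  rw [Finset.sum_comm (s := Finset.range n)]
  conv_rhs => rw [Finset.mul_sum]; enter [2]; rw [hone]
  rw [← Finset.sum_add_distrib, ← Finset.sum_add_distrib]
  refine (Finset.abs_sum_le_sum_abs _ _).trans (Finset.sum_le_sum fun s _ => ?_)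
  have hw0 := stateOcc0_nonneg hQ0 pol s0 h hlt s
  have hw1 : stateOcc0 Q pol s0 h s ≤ 1 := by
    rw [← sum_stateOcc0 hQ1 pol s0 h hlt]
    exact Finset.single_le_sum (fun s _ => stateOcc0_nonneg hQ0 pol s0 h hlt s)
      (Finset.mem_univ s)
  rw [sum_occ0_mul Q pol s0 h s fun a =>
    min 1 ((br / 2) / (1 + ∑ i ∈ Finset.range n, occ0 Q (pols i) s0 h s a)), abs_mul,
    abs_of_nonneg hw0]
  set w := stateOcc0 Q pol s0 h s
  set d := f h s (pol h s) - g h s (pol h s) with hd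
  set M := ∑ i ∈ Finset.range n, occ0 Q (pols i) s0 h s (pol h s) with hM
  have hM0 : 0 ≤ M := Finset.sum_nonneg fun i _ => occ0_nonneg hQ0 (pols i) s0 hlt _ _
  have hd1 : |d| ≤ 1 := hfg _ _ _
  have hd2 : d ^ 2 ≤ 1 := by
    rw [← sq_abs]
    exact pow_le_one₀ (abs_nonneg _) hd1
  have hsum : M * d ^ 2 ≤ ∑ i ∈ Finset.range n, stateOcc0 Q (pols i) s0 h s *
      (f h s (pols i h s) - g h s (pols i h s)) ^ 2 := by
    rw [hM, Finset.sum_mul]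
    refine Finset.sum_le_sum fun i _ => ?_
    rw [occ0]
    split_ifs with he
    · rw [hd, he]
    · rw [zero_mul]
      exact mul_nonneg (stateOcc0_nonneg hQ0 (pols i) s0 h hlt s) (sq_nonneg _)
  have hA := mul_le_mul_of_nonneg_left
    (abs_le_min_add_sq hd1 hbr (show 0 < 1 + M by linarith)) hw0
  have hB : w * ((1 + M) * d ^ 2) ≤ w + ∑ i ∈ Finset.range n, stateOcc0 Q (pols i) s0 h s *
      (f h s (pols i h s) - g h s (pols i h s)) ^ 2 := by
    have h1 : w * d ^ 2 ≤ w := mul_le_of_le_one_right hw0 hd2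
    have h2 : w * (M * d ^ 2) ≤ M * d ^ 2 := mul_le_of_le_one_left (by positivity) hw1
    linarith
  have hC := mul_le_mul_of_nonneg_left hB (show 0 ≤ 1 / (2 * br) by positivity)
  linarith

/-- Confidence bound for rewards approximation w.r.t. the approximated dynamics
(`lemma:CB-rewards-approx-p-main`). -/
theorem stmt8
    (H : ℕ) (hH : 1 ≤ H)
    (s0 : S 0) (hS0 : ∀ s : S 0, s = s0)
    (D : C → ℝ) (hD0 : ∀ c, 0 ≤ D c) (hD1 : (∑ c, D c) = 1)
    (t : ℕ) (ht : 1 ≤ t) (br : ℝ) (hbr : 0 < br)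
    (fstar fhat : C → ∀ h, S h → A → ℝ)
    (hfstar : ∀ c h s a, 0 ≤ fstar c h s a ∧ fstar c h s a ≤ 1)
    (hfhat : ∀ c h s a, 0 ≤ fhat c h s a ∧ fhat c h s a ≤ 1)
    (Pstar Phat : C → ∀ h, S h → A → S (h + 1) → ℝ)
    (hPstar0 : ∀ c h, h < H → ∀ s a s', 0 ≤ Pstar c h s a s')
    (hPstar1 : ∀ c h, h < H → ∀ s a, (∑ s', Pstar c h s a s') = 1)
    (hPhat0 : ∀ c h, h < H → ∀ s a s', 0 ≤ Phat c h s a s')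
    (hPhat1 : ∀ c h, h < H → ∀ s a, (∑ s', Phat c h s a s') = 1)
    (pols : ℕ → C → ∀ h, S h → A) :
    ∀ pol : C → ∀ h, S h → A,
      |∑ c, D c * (val (Phat c) (fstar c) (pol c) H 0 s0 -
          val (Phat c) (fhat c) (pol c) H 0 s0)| ≤
        (∑ c, D c * ∑ h ∈ Finset.range H, ∑ s : S h, ∑ a : A,
            occ0 (Phat c) (pol c) s0 h s a * bonusR Phat pols s0 t br c h s a) +
        (3 / (2 * br)) *
          (∑ c, D c * ∑ i ∈ Finset.range (t - 1), ∑ h ∈ Finset.range H,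
            ∑ s : S h, ∑ a : A,
              occ0 (Pstar c) (pols i c) s0 h s a *
                (fstar c h s a - fhat c h s a) ^ 2) +
        (9 * (H : ℝ) ^ 2 / (2 * br)) *
          (∑ c, D c * ∑ i ∈ Finset.range (t - 1), ∑ h ∈ Finset.range H,
            ∑ s : S h, ∑ a : A,
              occ0 (Pstar c) (pols i c) s0 h s a *
                hellingerSq (Pstar c h s a) (Phat c h s a)) +
        (H : ℝ) / (2 * br) := by
  intro pol
  have hfg : ∀ c h s a, |fstar c h s a - fhat c h s a| ≤ 1 := fun c h s a => by
    rw [abs_le]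
    constructor <;> linarith [(hfstar c h s a).1, (hfstar c h s a).2, (hfhat c h s a).1,
      (hfhat c h s a).2]
  have hsq : ∀ c h s a, 0 ≤ (fstar c h s a - fhat c h s a) ^ 2 ∧
      (fstar c h s a - fhat c h s a) ^ 2 ≤ 1 := fun c h s a => by
    refine ⟨sq_nonneg _, ?_⟩
    rw [← sq_abs]
    exact pow_le_one₀ (abs_nonneg _) (hfg c h s a)
  have hconst : (H : ℝ) / (2 * br) = ∑ c, D c * (H / (2 * br)) := by
    rw [← Finset.sum_mul, hD1, one_mul]
  rw [hconst, Finset.mul_sum, Finset.mul_sum, ← Finset.sum_add_distrib,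
    ← Finset.sum_add_distrib, ← Finset.sum_add_distrib]
  refine (Finset.abs_sum_le_sum_abs _ _).trans (Finset.sum_le_sum fun c _ => ?_)
  rw [abs_mul, abs_of_nonneg (hD0 c)]
  have hbonus := abs_val_sub_le_bonus (hPhat0 c) (hPhat1 c) (hfg c) (fun i => pols i c)
    (pol c) s0 (t - 1) hbr
  have hchange := Finset.sum_le_sum fun i (_ : i ∈ Finset.range (t - 1)) =>
    val_le_change_of_measure hH (hPstar0 c) (hPhat0 c) (hPhat1 c) (hsq c) (pols i c) s0
  have hR : ∀ i h (s : S h), ∑ a : A, occ0 (Pstar c) (pols i c) s0 h s a *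
      (fstar c h s a - fhat c h s a) ^ 2 = stateOcc0 (Pstar c) (pols i c) s0 h s *
        (fstar c h s (pols i c h s) - fhat c h s (pols i c h s)) ^ 2 := fun i h s =>
    sum_occ0_mul _ _ _ _ _ fun a => (fstar c h s a - fhat c h s a) ^ 2
  have hE : ∀ i h (s : S h), ∑ a : A, occ0 (Pstar c) (pols i c) s0 h s a *
      hellingerSq (Pstar c h s a) (Phat c h s a) = stateOcc0 (Pstar c) (pols i c) s0 h s *
        hellingerSq (Pstar c h s (pols i c h s)) (Phat c h s (pols i c h s)) := fun i h s =>
    sum_occ0_mul _ _ _ _ _ fun a => hellingerSq (Pstar c h s a) (Phat c h s a)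
  simp only [hR, hE, bonusR]
  simp only [mul_add, mul_left_comm _ ((H : ℝ) ^ 2), Finset.sum_add_distrib,
    ← Finset.mul_sum] at hchange
  have hE0 : 0 ≤ ∑ i ∈ Finset.range (t - 1), ∑ h ∈ Finset.range H, ∑ s : S h,
      stateOcc0 (Pstar c) (pols i c) s0 h s *
        hellingerSq (Pstar c h s (pols i c h s)) (Phat c h s (pols i c h s)) :=
    Finset.sum_nonneg fun i _ => Finset.sum_nonneg fun h hh => Finset.sum_nonneg fun s _ =>
      mul_nonneg (stateOcc0_nonneg (hPstar0 c) _ s0 h (Finset.mem_range.1 hh).le s)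
        (hellingerSq_nonneg _ _)
  set E := ∑ i ∈ Finset.range (t - 1), ∑ h ∈ Finset.range H, ∑ s : S h,
      stateOcc0 (Pstar c) (pols i c) s0 h s *
        hellingerSq (Pstar c h s (pols i c h s)) (Phat c h s (pols i c h s))
  set R := ∑ i ∈ Finset.range (t - 1), ∑ h ∈ Finset.range H, ∑ s : S h,
      stateOcc0 (Pstar c) (pols i c) s0 h s *
        (fstar c h s (pols i c h s) - fhat c h s (pols i c h s)) ^ 2
  have hscaled := mul_le_mul_of_nonneg_left hchange (show 0 ≤ 1 / (2 * br) by positivity)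
  have hslack : 1 / (2 * br) * (3 * R + (H : ℝ) ^ 2 * (3 * E)) ≤
      3 / (2 * br) * R + 9 * (H : ℝ) ^ 2 / (2 * br) * E := by
    have h1 : 0 ≤ 6 * (H : ℝ) ^ 2 / (2 * br) * E := by positivity
    have h2 : 3 / (2 * br) * R + 9 * (H : ℝ) ^ 2 / (2 * br) * E -
        1 / (2 * br) * (3 * R + (H : ℝ) ^ 2 * (3 * E)) = 6 * (H : ℝ) ^ 2 / (2 * br) * E := by
      ring
    linarith
  have hfinal := mul_le_mul_of_nonneg_left (hbonus.trans
    (add_le_add_left (add_le_add_right (hscaled.trans hslack) _) _)) (hD0 c)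
  linarith

end
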